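/- Every SCG admits a 2-approximate strong equilibrium: a strategy vector s such that for every nonempty coalition S ⊆ N and every strategy vector s' agreeing with s outside S, some player i ∈ S has 2·u_i(s) ≥ u_i(s'). -/

import Mathlib

open Finset

/-- A social coordination game (SCG): intrinsic weights `w i k`, symmetric nonnegative
coordination weights `cw i j`, and sharing coefficients `gam i j` with
`gam i j + gam j i = 1` for distinct players. -/
structure SCG (N M : Type*) [Fintype N] [DecidableEq N] [Fintype M] [DecidableEq M] where
  w : N → M → ℝ
  cw : N → N → ℝ
  gam : N → N → ℝ
  w_nonneg : ∀ i k, 0 ≤ w i k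
  cw_nonneg : ∀ i j, 0 ≤ cw i j
  cw_symm : ∀ i j, cw i j = cw j i
  gam_nonneg : ∀ i j, 0 ≤ gam i j
  gam_sum : ∀ i j, i ≠ j → gam i j + gam j i = 1

namespace SCG

variable {N M : Type*} [Fintype N] [DecidableEq N] [Fintype M] [DecidableEq M]

/-- Player `i`'s utility under strategy vector `s`. -/
def util (G : SCG N M) (s : N → M) (i : N) : ℝ :=
  G.w i (s i) + ∑ j ∈ univ.filter (fun j => j ≠ i ∧ s j = s i), G.gam i j * G.cw i j

/-- Social welfare of a strategy vector. -/
def welfare (G : SCG N M) (s : N → M) : ℝ := ∑ i, G.util s i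

/-- Pure Nash equilibrium. -/
def NashEq (G : SCG N M) (s : N → M) : Prop :=
  ∀ (i : N) (k : M), G.util (Function.update s i k) i ≤ G.util s i

/-- `α`-approximate equilibrium. -/
def ApproxEq (G : SCG N M) (α : ℝ) (s : N → M) : Prop :=
  ∀ (i : N) (k : M), G.util (Function.update s i k) i ≤ α * G.util s i

/-- The directed coordination benefit that player `i` draws from the players in `Q`. -/
def benefit (G : SCG N M) (i : N) (Q : Finset N) : ℝ :=
  ∑ j ∈ Q.erase i, G.gam i j * G.cw i j

lemma benefit_mono (G : SCG N M) (i : N) {P Q : Finset N} (h : P ⊆ Q) :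
    G.benefit i P ≤ G.benefit i Q :=
  sum_le_sum_of_subset_of_nonneg (erase_subset_erase i h)
    fun j _ _ => mul_nonneg (G.gam_nonneg i j) (G.cw_nonneg i j)

lemma benefit_union_le (G : SCG N M) (i : N) (P Q : Finset N) :
    G.benefit i (P ∪ Q) ≤ G.benefit i P + G.benefit i Q := by
  unfold benefit
  rw [erase_union_distrib, ← sum_union_inter]
  exact le_add_of_nonneg_right
    (sum_nonneg fun j _ => mul_nonneg (G.gam_nonneg i j) (G.cw_nonneg i j))

lemma util_eq_add_benefit (G : SCG N M) (s : N → M) (i : N) :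
    G.util s i = G.w i (s i) + G.benefit i (univ.filter fun j => s j = s i) := by
  unfold util benefit
  congr 2
  ext j
  simp

/-- The utility player `i` gets from strategy `k` when only the players outside `F` are
committed to their strategies in `s`. -/
def committedUtil (G : SCG N M) (F : Finset N) (s : N → M) (i : N) (k : M) : ℝ :=
  G.w i k + G.benefit i (univ.filter fun j => j ∉ F ∧ s j = k)

/-- The utility player `i` gets from strategy `k` when all players of `F` join in. -/
def optimisticUtil (G : SCG N M) (F : Finset N) (s : N → M) (i : N) (k : M) : ℝ :=
  G.w i k + G.benefit i ((univ.filter fun j => j ∉ F ∧ s j = k) ∪ F)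

lemma optimisticUtil_le (G : SCG N M) (F : Finset N) (s : N → M) (i : N) (k : M) :
    G.optimisticUtil F s i k ≤ G.committedUtil F s i k + G.benefit i F := by
  unfold optimisticUtil committedUtil
  linarith [G.benefit_union_le i (univ.filter fun j => j ∉ F ∧ s j = k) F]

lemma util_le_optimisticUtil (G : SCG N M) {F : Finset N} {s s' : N → M}
    (h : ∀ j ∉ F, s' j = s j) (i : N) :
    G.util s' i ≤ G.optimisticUtil F s i (s' i) := by
  rw [util_eq_add_benefit, optimisticUtil]
  gcongr
  apply benefit_mono
  intro j hj
  by_cases hF : j ∈ F <;> simp_all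

lemma committedUtil_le_util (G : SCG N M) {F : Finset N} {s s' : N → M}
    (h : ∀ j ∉ F, s' j = s j) (i : N) :
    G.committedUtil F s i (s' i) ≤ G.util s' i := by
  rw [util_eq_add_benefit, committedUtil]
  gcongr
  apply benefit_mono
  intro j hj
  simp_all

/-- If no single player of `F` can safely commit, then every player of `F` values the company
of `F` so much that they can all be placed on a common strategy. -/
lemma optimisticUtil_le_two_mul_benefit [Nonempty M] (G : SCG N M) {F : Finset N} {s : N → M}
    {i : N}
    (h : ∀ k, ∃ k', 2 * G.committedUtil F s i k < G.optimisticUtil F s i k') (k : M) :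
    G.optimisticUtil F s i k ≤ 2 * G.benefit i F := by
  obtain ⟨b, hb⟩ := Finite.exists_max (G.committedUtil F s i)
  obtain ⟨k', hk'⟩ := h b
  linarith [G.optimisticUtil_le F s i k, G.optimisticUtil_le F s i k', hb k, hb k']

/-- Any commitment of the players outside `F` extends to a strategy vector at which no
coalition inside `F` has a deviation more than doubling all its members' utilities. -/
lemma exists_extension_two_approx_strong [Nonempty M] (G : SCG N M) (F : Finset N)
    (s : N → M) :
    ∃ t : N → M, (∀ j ∉ F, t j = s j) ∧
      ∀ S ⊆ F, S.Nonempty → ∀ s' : N → M, (∀ i ∉ S, s' i = t i) →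
        ∃ i ∈ S, G.util s' i ≤ 2 * G.util t i := by
  induction F using Finset.strongInduction generalizing s with
  | H F ih =>
    by_cases hsafe : ∃ i ∈ F, ∃ k, ∀ k',
        G.optimisticUtil F s i k' ≤ 2 * G.committedUtil F s i k
    · obtain ⟨i, hi, k, hk⟩ := hsafe
      obtain ⟨t, ht, hS⟩ := ih (F.erase i) (erase_ssubset hi) (Function.update s i k)
      have hti : t i = k := by simpa using ht i (by simp)
      have hts : ∀ j ∉ F, t j = s j := fun j hj => by
        rw [ht j (by simp [hj]), Function.update_of_ne (by rintro rfl; exact hj hi)]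
      refine ⟨t, hts, fun S hSF hne s' hs' => ?_⟩
      by_cases hiS : i ∈ S
      · refine ⟨i, hiS, ?_⟩
        have hs's : ∀ j ∉ F, s' j = s j := fun j hj =>
          (hs' j fun h => hj (hSF h)).trans (hts j hj)
        have hlow := G.committedUtil_le_util hts i
        rw [hti] at hlow
        linarith [G.util_le_optimisticUtil hs's i, hk (s' i)]
      · exact hS S (subset_erase.2 ⟨hSF, hiS⟩) hne s' hs'
    · push Not at hsafe
      obtain ⟨c⟩ := ‹Nonempty M›
      have hts : ∀ j ∉ F, (if j ∈ F then c else s j) = s j := fun j hj => if_neg hj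
      refine ⟨fun j => if j ∈ F then c else s j, hts, fun S hSF ⟨i, hi⟩ s' hs' => ⟨i, hi, ?_⟩⟩
      have hs's : ∀ j ∉ F, s' j = s j := fun j hj =>
        (hs' j fun h => hj (hSF h)).trans (hts j hj)
      have hlow : G.benefit i F ≤ G.util (fun j => if j ∈ F then c else s j) i := by
        rw [util_eq_add_benefit]
        refine le_add_of_nonneg_of_le (G.w_nonneg _ _) (G.benefit_mono i fun j hj => ?_)
        simp [hj, hSF hi]
      have := G.optimisticUtil_le_two_mul_benefit (hsafe i (hSF hi)) (s' i)
      linarith [G.util_le_optimisticUtil hs's i]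

/-- Every SCG admits a 2-approximate strong equilibrium: in any coalitional deviation,
some member of the coalition improves by a factor of at most 2. -/
theorem exists_two_approx_strong [Nonempty N] [Nonempty M] (G : SCG N M) :
    ∃ s : N → M, ∀ S : Finset N, S.Nonempty → ∀ s' : N → M, (∀ i ∉ S, s' i = s i) →
      ∃ i ∈ S, G.util s' i ≤ 2 * G.util s i := by
  obtain ⟨c⟩ := ‹Nonempty M›
  have : Nonempty M := ⟨c⟩
  obtain ⟨t, -, ht⟩ := G.exists_extension_two_approx_strong univ fun _ => c
  exact ⟨t, fun S => ht S (subset_univ S)⟩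

end SCG
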